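/- arXiv:1407.3988 — 2 statements merged into one kernel-verified Lean document; each statement's English description precedes it below -/
import Mathlib

section
/- Let (A, J) and (B, K) be flip pairs over finite sets. If the shift-flip systems (X_A, σ_A, φ_{J,A}) and (X_B, σ_B, φ_{K,B}) are conjugate (there is a homeomorphism θ : X_A → X_B with θ ∘ σ_A = σ_B ∘ θ and θ ∘ φ_{J,A} = φ_{K,B} ∘ θ), then there exists an even positive integer n such that there is a strong shift-flip equivalence of lag n from (A, J) to (B, K). (Theorem 2.4.) -/
open Matrix

/-- A zero-one integer matrix. -/
def IsZeroOne {α β : Type*} (M : Matrix α β ℤ) : Prop := ∀ a b, M a b = 0 ∨ M a b = 1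

/-- A flip pair: a pair `(A, J)` of zero-one square matrices with `AJ = JAᵀ` and `J² = I`. -/
def IsFlipPair {α : Type*} [Fintype α] [DecidableEq α] (A J : Matrix α α ℤ) : Prop :=
  IsZeroOne A ∧ IsZeroOne J ∧ A * J = J * Aᵀ ∧ J * J = 1

/-- The topological Markov chain `X_A` determined by `A`, as a subtype of `ℤ → α`
(which carries the product topology when `α` is a topological space). -/
abbrev SFT {α : Type*} (A : Matrix α α ℤ) :=
  {x : ℤ → α // ∀ i : ℤ, A (x i) (x (i + 1)) = 1}

/-- The shift map `σ_A` on `X_A`, as a bijection: `σ_A(x)_i = x_{i+1}`. -/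
def shiftEquiv {α : Type*} (A : Matrix α α ℤ) : Equiv.Perm (SFT A) where
  toFun x := ⟨fun i => x.1 (i + 1), fun i => x.2 (i + 1)⟩
  invFun x := ⟨fun i => x.1 (i - 1), fun i => by
    have h := x.2 (i - 1); rwa [show i - 1 + 1 = i + 1 - 1 by ring] at h⟩
  left_inv x := Subtype.ext (funext fun i => by
    show x.1 (i - 1 + 1) = x.1 i
    norm_num)
  right_inv x := Subtype.ext (funext fun i => by
    show x.1 (i + 1 - 1) = x.1 i
    norm_num)

/-- A pair of square integer matrices over some finite alphabet. -/
structure MatPair where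
  ι : Type*
  [fin : Fintype ι]
  [deq : DecidableEq ι]
  A : Matrix ι ι ℤ
  J : Matrix ι ι ℤ

attribute [instance] MatPair.fin MatPair.deq

def MatPair.IsFlip (P : MatPair) : Prop := IsFlipPair P.A P.J

/-- A half elementary equivalence from `(P.A, P.J)` to `(Q.A, Q.J)`: a pair `(R, S)` of
zero-one matrices with `P.A = RS`, `Q.A = SR`, and `S = Q.J Rᵀ P.J`. -/
def HalfElemEquiv (P Q : MatPair) : Prop :=
  ∃ (R : Matrix P.ι Q.ι ℤ) (S : Matrix Q.ι P.ι ℤ),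
    IsZeroOne R ∧ IsZeroOne S ∧ P.A = R * S ∧ Q.A = S * R ∧ S = Q.J * Rᵀ * P.J

/-- A strong shift-flip equivalence of lag `k` from `P` to `Q`: a chain of `k` half elementary
equivalences through flip pairs. -/
def SSFE (P Q : MatPair) (k : ℕ) : Prop :=
  ∃ c : Fin (k + 1) → MatPair, c 0 = P ∧ c (Fin.last k) = Q ∧
    (∀ i, (c i).IsFlip) ∧ ∀ i : Fin k, HalfElemEquiv (c i.castSucc) (c i.succ)

section InvolutionMatrix

variable {α β : Type*} [DecidableEq α] {τ : α → α}

/-- The zero-one matrix of a self-map. -/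
def involutionMatrix (τ : α → α) : Matrix α α ℤ := Matrix.of fun a b => if τ a = b then 1 else 0

theorem involutionMatrix_apply (a b : α) :
    involutionMatrix τ a b = if τ a = b then 1 else 0 := rfl

theorem involutionMatrix_mul_apply [Fintype α] (M : Matrix α β ℤ) (a : α) (b : β) :
    (involutionMatrix τ * M) a b = M (τ a) b := by
  simp [Matrix.mul_apply, involutionMatrix_apply]

theorem mul_involutionMatrix_apply [Fintype α] (hτ : ∀ v, τ (τ v) = v) (M : Matrix β α ℤ)
    (b : β) (a : α) : (M * involutionMatrix τ) b a = M b (τ a) := by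
  have h (j : α) : τ j = a ↔ j = τ a := ⟨fun e => e ▸ (hτ j).symm, fun e => e ▸ hτ a⟩
  simp [Matrix.mul_apply, involutionMatrix_apply, h]

end InvolutionMatrix

/-- A finite directed graph without multiple edges, with a direction-reversing involution. -/
structure FlipGraph where
  V : Type
  [fin : Fintype V]
  [deq : DecidableEq V]
  Adj : V → V → Prop
  τ : V → V
  τ_τ : ∀ v, τ (τ v) = v
  adj_τ : ∀ {u v}, Adj u v → Adj (τ v) (τ u)

attribute [instance] FlipGraph.fin FlipGraph.deq

namespace FlipGraph

open Classical in
/-- The adjacency matrix and the involution matrix of a flip graph. -/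
noncomputable abbrev toMatPair (G : FlipGraph) : MatPair where
  ι := G.V
  A := Matrix.of fun a b => if G.Adj a b then 1 else 0
  J := involutionMatrix G.τ

theorem τ_eq_iff (G : FlipGraph) {u v : G.V} : G.τ u = v ↔ u = G.τ v :=
  ⟨fun h => h ▸ (G.τ_τ u).symm, fun h => h ▸ G.τ_τ v⟩

theorem adj_τ_comm (G : FlipGraph) {u v : G.V} : G.Adj u (G.τ v) ↔ G.Adj v (G.τ u) :=
  ⟨fun h => by simpa [G.τ_τ] using G.adj_τ h, fun h => by simpa [G.τ_τ] using G.adj_τ h⟩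

theorem toMatPair_isFlip (G : FlipGraph) : G.toMatPair.IsFlip := by
  refine ⟨fun a b => ?_, fun a b => ?_, ?_, ?_⟩
  · by_cases h : G.Adj a b <;> simp [h]
  · by_cases h : G.τ a = b <;> simp [involutionMatrix_apply, h]
  · ext a b
    rw [mul_involutionMatrix_apply G.τ_τ, involutionMatrix_mul_apply, Matrix.transpose_apply]
    classical exact if_congr G.adj_τ_comm rfl rfl
  · ext a b
    rw [mul_involutionMatrix_apply G.τ_τ, Matrix.one_apply]
    exact if_congr (by rw [τ_eq_iff, τ_τ]) rfl rfl

/-- The combinatorial form of a half elementary equivalence. -/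
def Step (G H : FlipGraph) : Prop :=
  ∃ (r : G.V → H.V → Prop) (s : H.V → G.V → Prop),
    (∀ v u, s v u ↔ r (G.τ u) (H.τ v)) ∧
    (∀ u u', G.Adj u u' ↔ ∃ v, r u v ∧ s v u') ∧
    (∀ u u' v w, r u v → s v u' → r u w → s w u' → v = w) ∧
    (∀ v v', H.Adj v v' ↔ ∃ u, s v u ∧ r u v') ∧
    (∀ v v' u w, s v u → r u v' → s v w → r w v' → u = w)

theorem Step.symm {G H : FlipGraph} (h : Step G H) : Step H G := by
  obtain ⟨r, s, h1, h2, h3, h4, h5⟩ := h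
  exact ⟨s, r, fun v u => by simp [h1, τ_τ], h4, h5, h2, h3⟩

open Classical in
theorem sum_ite_and_of_unique {ι : Type*} [Fintype ι] {p q : ι → Prop} {a : Prop}
    (h : a ↔ ∃ i, p i ∧ q i) (hu : ∀ i j, p i → q i → p j → q j → i = j) :
    (if a then (1 : ℤ) else 0) = ∑ i, (if p i then 1 else 0) * (if q i then 1 else 0) := by
  by_cases ha : a
  · obtain ⟨i, hp, hq⟩ := h.1 ha
    rw [if_pos ha, Finset.sum_eq_single i]
    · simp [hp, hq]
    · intro j _ hj
      by_cases hpj : p j <;> by_cases hqj : q j <;> simp [hpj, hqj]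
      exact hj (hu _ _ hpj hqj hp hq)
    · simp
  · rw [if_neg ha, Finset.sum_eq_zero]
    intro j _
    by_cases hpj : p j <;> by_cases hqj : q j <;> simp [hpj, hqj]
    exact ha (h.2 ⟨j, hpj, hqj⟩)

theorem Step.halfElemEquiv {G H : FlipGraph} (h : Step G H) :
    HalfElemEquiv G.toMatPair H.toMatPair := by
  classical
  obtain ⟨r, s, h1, h2, h3, h4, h5⟩ := h
  refine ⟨Matrix.of fun u v => if r u v then 1 else 0,
    Matrix.of fun v u => if s v u then 1 else 0, fun a b => ?_, fun a b => ?_, ?_, ?_, ?_⟩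
  · by_cases h : r a b <;> simp [h]
  · by_cases h : s a b <;> simp [h]
  · ext u u'
    simpa only [toMatPair, Matrix.mul_apply, Matrix.of_apply] using
      sum_ite_and_of_unique (h2 u u') (h3 u u')
  · ext v v'
    simpa only [toMatPair, Matrix.mul_apply, Matrix.of_apply] using
      sum_ite_and_of_unique (h4 v v') (h5 v v')
  · ext v u
    rw [mul_involutionMatrix_apply G.τ_τ, involutionMatrix_mul_apply, Matrix.transpose_apply]
    simp only [Matrix.of_apply, h1]

/-- `Chain n G H`: the flip graphs `G` and `H` are joined by `n` steps. -/
inductive Chain : ℕ → FlipGraph → FlipGraph → Prop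
  | nil (G : FlipGraph) : Chain 0 G G
  | cons {n : ℕ} {G H K : FlipGraph} : Step G H → Chain n H K → Chain (n + 1) G K

theorem Chain.trans {m n : ℕ} {G H K : FlipGraph} (h : Chain m G H) (h' : Chain n H K) :
    Chain (m + n) G K := by
  induction h with
  | nil => simpa using h'
  | cons s _ ih => rw [Nat.add_right_comm]; exact .cons s (ih h')

theorem Step.chain {G H : FlipGraph} (h : Step G H) : Chain 1 G H := .cons h (.nil H)

theorem Chain.symm {n : ℕ} {G H : FlipGraph} (h : Chain n G H) : Chain n H G := by
  induction h with
  | nil G => exact .nil G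
  | cons s _ ih => exact ih.trans s.symm.chain

theorem Chain.of_forall_lt (f : ℕ → FlipGraph) (n : ℕ)
    (h : ∀ i < n, Step (f i) (f (i + 1))) : Chain n (f 0) (f n) := by
  induction n with
  | zero => exact .nil _
  | succ n ih =>
    exact (ih fun i hi => h i (hi.trans n.lt_succ_self)).trans (h n n.lt_succ_self).chain

theorem Chain.ssfe {n : ℕ} {G H : FlipGraph} (h : Chain n G H) :
    SSFE G.toMatPair H.toMatPair n := by
  induction h with
  | nil G => exact ⟨fun _ => G.toMatPair, rfl, rfl, fun _ => G.toMatPair_isFlip, fun i => i.elim0⟩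
  | @cons n G H K s _ ih =>
    obtain ⟨c, h0, hl, hf, hs⟩ := ih
    refine ⟨Fin.cons G.toMatPair c, rfl, ?_, ?_, ?_⟩
    · rw [← Fin.succ_last, Fin.cons_succ, hl]
    · intro i
      refine Fin.cases G.toMatPair_isFlip (fun i => ?_) i
      simpa using hf i
    · intro i
      refine Fin.cases ?_ (fun i => ?_) i
      · simpa [h0] using s.halfElemEquiv
      · rw [← Fin.succ_castSucc, Fin.cons_succ, Fin.cons_succ]
        exact hs i

/-- The graph of edges of a flip graph. -/
noncomputable def edgeGraph (G : FlipGraph) : FlipGraph where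
  V := {e : G.V × G.V // G.Adj e.1 e.2}
  fin := Fintype.ofFinite _
  Adj e f := e.1.2 = f.1.1
  τ e := ⟨(G.τ e.1.2, G.τ e.1.1), G.adj_τ e.2⟩
  τ_τ e := by simp [τ_τ]
  adj_τ h := by simp [h]

/-- An isomorphism of `H` onto an induced subgraph of `G`, compatible with the involutions. -/
structure IsEmbedding {H G : FlipGraph} (f : H.V → G.V) : Prop where
  inj : Function.Injective f
  adj : ∀ u v, H.Adj u v ↔ G.Adj (f u) (f v)
  map_τ : ∀ u, f (H.τ u) = G.τ (f u)

theorem IsEmbedding.step_edgeGraph {H G : FlipGraph} {f : H.V → G.V} (hf : IsEmbedding f)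
    (cover : ∀ a u b, G.Adj a u → G.Adj u b → u ∈ Set.range f) : Step H G.edgeGraph := by
  refine ⟨fun u e => f u = e.1.1, fun e u => e.1.2 = f u, ?_, ?_, ?_, ?_, ?_⟩
  · intro e u
    simp only [edgeGraph, hf.map_τ, τ_eq_iff, τ_τ]
    exact eq_comm
  · intro u u'
    rw [hf.adj]
    constructor
    · exact fun h => ⟨⟨(f u, f u'), h⟩, rfl, rfl⟩
    · rintro ⟨e, h, h'⟩
      rw [h, ← h']
      exact e.2
  · intro u u' e e' h1 h2 h3 h4
    exact Subtype.ext (Prod.ext (h1.symm.trans h3) (h2.trans h4.symm))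
  · intro e e'
    constructor
    · intro h
      change e.1.2 = e'.1.1 at h
      obtain ⟨u, hu⟩ := cover _ _ _ e.2 (h ▸ e'.2)
      exact ⟨u, hu.symm, hu.trans h⟩
    · rintro ⟨u, h, h'⟩
      exact h.trans h'
  · intro e e' u w h1 _ h3 _
    exact hf.inj (h1.symm.trans h3)

theorem IsEmbedding.chain_two {H G : FlipGraph} {f : H.V → G.V} (hf : IsEmbedding f)
    (cover : ∀ a u b, G.Adj a u → G.Adj u b → u ∈ Set.range f) : Chain 2 G H := by
  have hid : IsEmbedding (H := G) (G := G) id :=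
    ⟨Function.injective_id, fun _ _ => Iff.rfl, fun _ => rfl⟩
  exact (hid.step_edgeGraph fun _ u _ _ _ => ⟨u, rfl⟩).chain.trans
    (hf.step_edgeGraph cover).symm.chain

/-- The subgraph of vertices with a predecessor and a successor. -/
noncomputable def trim (G : FlipGraph) : FlipGraph where
  V := {u : G.V // (∃ a, G.Adj a u) ∧ ∃ b, G.Adj u b}
  fin := Fintype.ofFinite _
  Adj u v := G.Adj u.1 v.1
  τ u := ⟨G.τ u.1, u.2.2.imp' G.τ fun _ => G.adj_τ, u.2.1.imp' G.τ fun _ => G.adj_τ⟩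
  τ_τ _ := Subtype.ext (G.τ_τ _)
  adj_τ h := G.adj_τ h

theorem exists_walk (G : FlipGraph) (h : ∀ u : G.V, (∃ a, G.Adj a u) ∧ ∃ b, G.Adj u b) (u : G.V) :
    ∃ w : ℤ → G.V, (∀ i, G.Adj (w i) (w (i + 1))) ∧ w 0 = u := by
  choose hp hs using h
  choose p hp using hp
  choose s hs using hs
  refine ⟨fun i => Int.casesOn i (fun n => s^[n] u) (fun n => p^[n + 1] u), ?_, rfl⟩
  rintro (n | _ | n)
  · change G.Adj (s^[n] u) (s^[n + 1] u)
    rw [Function.iterate_succ_apply']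
    exact hs _
  · exact hp u
  · change G.Adj (p^[n + 2] u) (p^[n + 1] u)
    rw [Function.iterate_succ_apply']
    exact hp _

theorem IsEmbedding.exists_even_chain {H G : FlipGraph} {f : H.V → G.V} (hf : IsEmbedding f)
    (ess : ∀ u, (∃ a, H.Adj a u) ∧ ∃ b, H.Adj u b)
    (full : ∀ w : ℤ → G.V, (∀ i, G.Adj (w i) (w (i + 1))) → w 0 ∈ Set.range f) :
    ∃ n, Even n ∧ Chain n G H := by
  induction hn : Fintype.card G.V using Nat.strong_induction_on generalizing G with
  | _ n ih =>
    by_cases h : ∀ u : G.V, (∃ a, G.Adj a u) ∧ ∃ b, G.Adj u b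
    · refine ⟨2, even_two, hf.chain_two fun _ u _ _ _ => ?_⟩
      obtain ⟨w, hw, rfl⟩ := G.exists_walk h u
      exact full w hw
    · push Not at h
      obtain ⟨u, hu⟩ := h
      have hlt : Fintype.card G.trim.V < n := by
        rw [← hn]
        refine Fintype.card_lt_of_injective_of_notMem (b := u) (fun v : G.trim.V => v.1)
          Subtype.val_injective ?_
        rintro ⟨v, rfl⟩
        obtain ⟨b, hb⟩ := v.2.2
        exact hu v.2.1 b hb
      let g : H.V → G.trim.V := fun v => ⟨f v,
        (ess v).1.imp' f fun _ => (hf.adj _ _).1, (ess v).2.imp' f fun _ => (hf.adj _ _).1⟩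
      have hg : IsEmbedding g :=
        ⟨fun a b hab => hf.inj (congrArg Subtype.val hab), hf.adj,
          fun v => Subtype.ext (hf.map_τ v)⟩
      obtain ⟨k, hk, hc⟩ := ih _ hlt hg (fun w hw => by
        obtain ⟨v, hv⟩ := full (fun i => (w i).1) hw
        exact ⟨v, Subtype.ext hv⟩) rfl
      have ht : IsEmbedding (H := G.trim) (G := G) Subtype.val :=
        ⟨Subtype.val_injective, fun _ _ => Iff.rfl, fun _ => rfl⟩
      exact ⟨2 + k, even_two.add hk,
        (ht.chain_two fun a v b ha hb => ⟨⟨v, ⟨a, ha⟩, ⟨b, hb⟩⟩, rfl⟩).trans hc⟩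

end FlipGraph

section Partition

variable {X : Type} {σ : Equiv.Perm X} {φ ψ : X → X} {s t : Setoid X}

/-- A finite partition invariant under `ψ`, where `ψ` acts on it as an involution
reversing `σ`. -/
structure IsFlipPartition (σ : Equiv.Perm X) (ψ : X → X) (s : Setoid X) : Prop where
  fin : Finite (Quotient s)
  map : ∀ x y, s x y → s (ψ x) (ψ y)
  invol : ∀ x, s (ψ (ψ x)) x
  rev : ∀ x, s (σ (ψ (σ x))) (ψ x)

/-- The transition graph of a flip partition. -/
noncomputable def partitionGraph (h : IsFlipPartition σ ψ s) : FlipGraph where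
  V := Quotient s
  fin := @Fintype.ofFinite _ h.fin
  deq := Classical.decEq _
  Adj u v := ∃ x, ⟦x⟧ = u ∧ ⟦σ x⟧ = v
  τ := Quotient.map ψ h.map
  τ_τ := by
    rintro ⟨x⟩
    exact Quotient.sound (h.invol x)
  adj_τ := by
    rintro _ _ ⟨x, rfl, rfl⟩
    exact ⟨ψ (σ x), rfl, Quotient.sound (h.rev x)⟩

theorem partitionGraph_congr {ψ' : X → X} (hs : IsFlipPartition σ ψ s)
    (ht : IsFlipPartition σ ψ' t) (h : s = t) (hψ : ψ = ψ') :
    partitionGraph hs = partitionGraph ht := by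
  subst h hψ
  rfl

theorem partitionGraph_step {ψ' : X → X} (hs : IsFlipPartition σ ψ s)
    (ht : IsFlipPartition σ ψ' t) (hψ : ∀ x, ψ' x = ψ (σ x))
    (hst : ∀ x y, s x y → s (σ x) (σ y) → t x y)
    (hts : ∀ x y, t x y → t (σ x) (σ y) → s (σ x) (σ y))
    (glue_t : ∀ x y, t x y → ∃ z, s z x ∧ t z x ∧ s (σ z) (σ y))
    (glue_s : ∀ x y, s (σ x) (σ y) → ∃ z, t z x ∧ s (σ z) (σ x) ∧ t (σ z) (σ y)) :
    FlipGraph.Step (partitionGraph hs) (partitionGraph ht) := by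
  let r : Quotient s → Quotient t → Prop := fun u v => ∃ x, ⟦x⟧ = u ∧ ⟦x⟧ = v
  let q : Quotient t → Quotient s → Prop := fun v u => ∃ x, ⟦x⟧ = v ∧ ⟦σ x⟧ = u
  have key_t : ∀ u v u', r u v → q v u' →
      ∃ z, (⟦z⟧ : Quotient s) = u ∧ (⟦z⟧ : Quotient t) = v ∧ (⟦σ z⟧ : Quotient s) = u' := by
    rintro _ _ _ ⟨x, rfl, rfl⟩ ⟨y, hxy, rfl⟩
    obtain ⟨z, h1, h2, h3⟩ := glue_t x y (Quotient.exact hxy.symm)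
    exact ⟨z, Quotient.sound h1, Quotient.sound h2, Quotient.sound h3⟩
  have key_s : ∀ v u v', q v u → r u v' →
      ∃ z, (⟦z⟧ : Quotient t) = v ∧ (⟦σ z⟧ : Quotient s) = u ∧ (⟦σ z⟧ : Quotient t) = v' := by
    rintro _ _ _ ⟨x, rfl, rfl⟩ ⟨y, hxy, rfl⟩
    obtain ⟨y, rfl⟩ := σ.surjective y
    obtain ⟨z, h1, h2, h3⟩ := glue_s x y (Quotient.exact hxy.symm)
    exact ⟨z, Quotient.sound h1, Quotient.sound h2, Quotient.sound h3⟩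
  refine ⟨r, q, ?_, ?_, ?_, ?_, ?_⟩
  · rintro v u
    constructor
    · rintro ⟨x, rfl, rfl⟩
      exact ⟨ψ' x, by rw [hψ]; rfl, rfl⟩
    · rintro ⟨x, hu, hv⟩
      refine ⟨ψ' x, ?_, ?_⟩
      · exact ((partitionGraph ht).τ_eq_iff.2 hv)
      · refine Eq.trans (Quotient.sound ?_) ((partitionGraph hs).τ_eq_iff.2 hu)
        rw [hψ]
        exact hs.rev x
  · intro u u'
    constructor
    · rintro ⟨x, h, h'⟩
      exact ⟨⟦x⟧, ⟨x, h, rfl⟩, ⟨x, rfl, h'⟩⟩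
    · rintro ⟨v, h, h'⟩
      obtain ⟨z, h1, -, h3⟩ := key_t _ _ _ h h'
      exact ⟨z, h1, h3⟩
  · intro u u' v w h1 h2 h3 h4
    obtain ⟨z, rfl, rfl, rfl⟩ := key_t _ _ _ h1 h2
    obtain ⟨y, a, rfl, b⟩ := key_t _ _ _ h3 h4
    exact Quotient.sound (hst _ _ (Quotient.exact a.symm) (Quotient.exact b.symm))
  · intro v v'
    constructor
    · rintro ⟨x, h, h'⟩
      exact ⟨⟦σ x⟧, ⟨x, h, rfl⟩, ⟨σ x, rfl, h'⟩⟩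
    · rintro ⟨u, h, h'⟩
      obtain ⟨z, h1, -, h3⟩ := key_s _ _ _ h h'
      exact ⟨z, h1, h3⟩
  · intro v v' u w h1 h2 h3 h4
    obtain ⟨z, rfl, rfl, rfl⟩ := key_s _ _ _ h1 h2
    obtain ⟨y, a, rfl, b⟩ := key_s _ _ _ h3 h4
    exact Quotient.sound (hts _ _ (Quotient.exact a.symm) (Quotient.exact b.symm))

/-- The map `c` identifies `X` (up to points with the same code) with the two-sided walks
on `G`, `σ` with the shift and `φ` with the flip. -/
structure IsCoding (G : FlipGraph) (σ : Equiv.Perm X) (φ : X → X) (c : X → ℤ → G.V) : Prop where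
  adj : ∀ x i, G.Adj (c x i) (c x (i + 1))
  surj : ∀ w : ℤ → G.V, (∀ i, G.Adj (w i) (w (i + 1))) → ∃ x, c x = w
  shift : ∀ x i, c (σ x) i = c x (i + 1)
  flip : ∀ x i, c (φ x) i = G.τ (c x (-i))

variable {G H : FlipGraph} {c : X → ℤ → G.V} {d : X → ℤ → H.V}

theorem IsCoding.flip_iterate (hc : IsCoding G σ φ c) (n : ℕ) (x : X) (i : ℤ) :
    c (φ (σ^[n] x)) i = G.τ (c x (n - i)) := by
  have h : ∀ (n : ℕ) (x : X) (i : ℤ), c (σ^[n] x) i = c x (i + n) := by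
    intro n
    induction n with
    | zero => simp
    | succ n ih =>
      intro x i
      rw [Function.iterate_succ_apply, ih, hc.shift]
      push_cast
      ring_nf
  rw [hc.flip, h]
  ring_nf

theorem IsCoding.exists_glue (hc : IsCoding G σ φ c) (x y : X) (a : ℤ)
    (h : G.Adj (c x a) (c y (a + 1))) :
    ∃ z, (∀ i ≤ a, c z i = c x i) ∧ ∀ i, a < i → c z i = c y i := by
  obtain ⟨z, hz⟩ := hc.surj (fun i => if i ≤ a then c x i else c y i) (fun i => by
    rcases lt_trichotomy i a with hi | rfl | hi
    · simpa [hi.le, show i + 1 ≤ a by lia] using hc.adj x i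
    · simpa using h
    · simpa [show ¬ i ≤ a by lia, show ¬ i + 1 ≤ a by lia] using hc.adj y i)
  refine ⟨z, fun i hi => ?_, fun i hi => ?_⟩
  · simp [hz, hi]
  · simp [hz, not_le.2 hi]

/-- The coordinate of `d x` at `i` is determined by the coordinates of `c x` within distance `m`
of `i`. -/
def IsLocal (c : X → ℤ → G.V) (d : X → ℤ → H.V) (m : ℕ) : Prop :=
  ∀ (x y : X) (i : ℤ), (∀ k : ℤ, i - m ≤ k → k ≤ i + m → c x k = c y k) → d x i = d y i

theorem IsLocal.mono {m n : ℕ} (h : IsLocal c d m) (hmn : m ≤ n) : IsLocal c d n :=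
  fun x y i hi => h x y i fun k _ _ => hi k (by lia) (by lia)

theorem IsCoding.exists_glue_of_isLocal (hc : IsCoding G σ φ c) {m : ℕ} (hl : IsLocal c d m)
    (x y : X) (a b : ℤ) (hab : a ≤ b) (h : ∀ i, a ≤ i → i ≤ b → c x i = c y i) :
    ∃ z, (∀ i ≤ b, c z i = c x i) ∧ (∀ i, a ≤ i → c z i = c y i) ∧
      (∀ i ≤ b - m, d z i = d x i) ∧ (∀ i, a + m ≤ i → d z i = d y i) := by
  obtain ⟨z, h1, h2⟩ := hc.exists_glue x y a (h a le_rfl hab ▸ hc.adj y a)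
  have h3 : ∀ i ≤ b, c z i = c x i := fun i hi => by
    rcases le_or_gt i a with hia | hia
    · exact h1 i hia
    · rw [h2 i hia, h i hia.le hi]
  have h4 : ∀ i, a ≤ i → c z i = c y i := fun i hi => by
    rcases hi.eq_or_lt with rfl | hia
    · rw [h1 _ le_rfl, h _ le_rfl hab]
    · exact h2 i hia
  exact ⟨z, h3, h4, fun i hi => hl _ _ _ fun k _ _ => h3 k (by lia),
    fun i hi => hl _ _ _ fun k _ _ => h4 k (by lia)⟩

/-- Agreement of `c` on `[a, b]` and of `d` on `[e, f]`. -/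
def windowSetoid (c : X → ℤ → G.V) (d : X → ℤ → H.V) (a b e f : ℤ) : Setoid X where
  r x y := (∀ i, a ≤ i → i ≤ b → c x i = c y i) ∧ (∀ i, e ≤ i → i ≤ f → d x i = d y i)
  iseqv := ⟨fun _ => ⟨fun _ _ _ => rfl, fun _ _ _ => rfl⟩,
    fun h => ⟨fun i hi hi' => (h.1 i hi hi').symm, fun i hi hi' => (h.2 i hi hi').symm⟩,
    fun h h' => ⟨fun i hi hi' => (h.1 i hi hi').trans (h'.1 i hi hi'),
      fun i hi hi' => (h.2 i hi hi').trans (h'.2 i hi hi')⟩⟩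

theorem windowSetoid_apply {a b e f : ℤ} {x y : X} :
    windowSetoid c d a b e f x y ↔
      (∀ i, a ≤ i → i ≤ b → c x i = c y i) ∧ (∀ i, e ≤ i → i ≤ f → d x i = d y i) := Iff.rfl

theorem windowSetoid_shift (hc : IsCoding G σ φ c) (hd : IsCoding H σ φ d) {a b e f : ℤ} {x y : X} :
    windowSetoid c d a b e f (σ x) (σ y) ↔
      windowSetoid c d (a + 1) (b + 1) (e + 1) (f + 1) x y := by
  simp only [windowSetoid_apply, hc.shift, hd.shift]
  refine and_congr ⟨fun h i _ _ => ?_, fun h i _ _ => h _ (by lia) (by lia)⟩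
    ⟨fun h i _ _ => ?_, fun h i _ _ => h _ (by lia) (by lia)⟩
  all_goals simpa using h (i - 1) (by lia) (by lia)

theorem finite_quotient_windowSetoid (a b e f : ℤ) :
    Finite (Quotient (windowSetoid c d a b e f)) := by
  let g : Quotient (windowSetoid c d a b e f) → (Set.Icc a b → G.V) × (Set.Icc e f → H.V) :=
    Quotient.lift (fun x => (fun i => c x i, fun i => d x i)) (fun x y h => Prod.ext
      (funext fun i => h.1 i i.2.1 i.2.2) (funext fun i => h.2 i i.2.1 i.2.2))
  refine Finite.of_injective g ?_
  rintro ⟨x⟩ ⟨y⟩ h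
  exact Quotient.sound ⟨fun i hi hi' => congrFun (congrArg Prod.fst h) ⟨i, hi, hi'⟩,
    fun i hi hi' => congrFun (congrArg Prod.snd h) ⟨i, hi, hi'⟩⟩

theorem windowSetoid_isFlipPartition (hc : IsCoding G σ φ c) (hd : IsCoding H σ φ d) (n : ℕ)
    {a b e f : ℤ} (hab : b < a ∨ a + b = n) (hef : f < e ∨ e + f = n) :
    IsFlipPartition σ (fun x => φ (σ^[n] x)) (windowSetoid c d a b e f) where
  fin := finite_quotient_windowSetoid a b e f
  map x y h := by
    refine ⟨fun i _ _ => ?_, fun i _ _ => ?_⟩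
    · rw [hc.flip_iterate, hc.flip_iterate, h.1 _ (by lia) (by lia)]
    · rw [hd.flip_iterate, hd.flip_iterate, h.2 _ (by lia) (by lia)]
  invol x := by
    refine ⟨fun i _ _ => ?_, fun i _ _ => ?_⟩
    · simp [hc.flip_iterate, G.τ_τ]
    · simp [hd.flip_iterate, H.τ_τ]
  rev x := by
    refine ⟨fun i _ _ => ?_, fun i _ _ => ?_⟩
    · rw [hc.shift, hc.flip_iterate, hc.flip_iterate, hc.shift]
      ring_nf
    · rw [hd.shift, hd.flip_iterate, hd.flip_iterate, hd.shift]
      ring_nf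

theorem IsCoding.exists_even_chain (hc : IsCoding G σ φ c) (k : ℤ) (n : ℕ) (hk : 2 * k = n)
    (hs : IsFlipPartition σ (fun x => φ (σ^[n] x)) s) (h : ∀ x y, s x y ↔ c x k = c y k) :
    ∃ m, Even m ∧ FlipGraph.Chain m G (partitionGraph hs) := by
  let f : (partitionGraph hs).V → G.V :=
    Quotient.lift (fun x => c x k) (fun x y hxy => (h x y).1 hxy)
  have hf : FlipGraph.IsEmbedding f := by
    refine ⟨?_, ?_, ?_⟩
    · rintro ⟨x⟩ ⟨y⟩ hxy
      exact Quotient.sound ((h x y).2 hxy)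
    · rintro ⟨x⟩ ⟨y⟩
      constructor
      · rintro ⟨z, hz, hz'⟩
        have h1 := (h _ _).1 (Quotient.exact hz)
        have h2 := (h _ _).1 (Quotient.exact hz')
        have := hc.adj z k
        rw [hc.shift] at h2
        rwa [h1, h2] at this
      · intro hxy
        obtain ⟨y', rfl⟩ := σ.surjective y
        have hxy' : G.Adj (c x k) (c (σ y') k) := hxy
        rw [hc.shift] at hxy'
        obtain ⟨z, h1, h2⟩ := hc.exists_glue x y' k hxy'
        refine ⟨z, Quotient.sound ((h _ _).2 (h1 k le_rfl)), Quotient.sound ((h _ _).2 ?_)⟩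
        rw [hc.shift, hc.shift, h2 _ (lt_add_one k)]
    · rintro ⟨x⟩
      change c (φ (σ^[n] x)) k = G.τ (c x k)
      rw [hc.flip_iterate, ← hk, two_mul, add_sub_cancel_right]
  refine hf.exists_even_chain ?_ ?_
  · rintro ⟨x⟩
    refine ⟨⟨⟦σ.symm x⟧, σ.symm x, rfl, ?_⟩, ⟨⟦σ x⟧, x, rfl, rfl⟩⟩
    rw [Equiv.apply_symm_apply]
    rfl
  · intro w hw
    obtain ⟨x, hx⟩ := hc.surj (fun i => w (i - k)) (fun i => by
      simpa [sub_add_eq_add_sub] using hw (i - k))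
    exact ⟨⟦x⟧, by change c x k = w 0; simp [hx]⟩

section Steps

theorem windowGraph_step_extend (hc : IsCoding G σ φ c) (hd : IsCoding H σ φ d) {m : ℕ}
    (hl : IsLocal c d m) (n : ℕ)
    (hs : IsFlipPartition σ (fun x => φ (σ^[n] x)) (windowSetoid c d 0 n 1 0))
    (ht : IsFlipPartition σ (fun x => φ (σ^[n + 1] x))
      (windowSetoid c d 0 (n + 1 : ℕ) 1 0)) :
    FlipGraph.Step (partitionGraph hs) (partitionGraph ht) := by
  refine partitionGraph_step hs ht (fun _ => rfl) ?_ ?_ ?_ ?_ <;>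
    simp only [windowSetoid_shift hc hd, windowSetoid_apply] <;> push_cast
  · grind
  · grind
  · exact fun x y h => ⟨x, by grind⟩
  · intro x y h
    obtain ⟨z, h1, h2, -, -⟩ :=
      hc.exists_glue_of_isLocal hl x y (0 + 1) (n + 1) (by lia) (fun i _ _ => h.1 i (by lia) (by lia))
    exact ⟨z, by grind⟩

theorem windowGraph_step_shrink (hc : IsCoding G σ φ c) (hd : IsCoding H σ φ d) {m : ℕ}
    (hl : IsLocal d c m) (n : ℕ) {a b : ℤ} (hab : a < b)
    (hs : IsFlipPartition σ (fun x => φ (σ^[n] x)) (windowSetoid c d 1 0 a b))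
    (ht : IsFlipPartition σ (fun x => φ (σ^[n + 1] x)) (windowSetoid c d 1 0 (a + 1) b)) :
    FlipGraph.Step (partitionGraph hs) (partitionGraph ht) := by
  refine partitionGraph_step hs ht (fun _ => rfl) ?_ ?_ ?_ ?_ <;>
    simp only [windowSetoid_shift hc hd, windowSetoid_apply]
  · grind
  · grind
  · intro x y h
    obtain ⟨z, h1, h2, -, -⟩ :=
      hd.exists_glue_of_isLocal hl x y (a + 1) b (by lia) h.2
    exact ⟨z, by grind⟩
  · exact fun x y h => ⟨x, by grind⟩

/-- Shrinking the `c`-window while extending the `d`-window. -/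
theorem windowGraph_step_exchange (hc : IsCoding G σ φ c) (hd : IsCoding H σ φ d) {m p i : ℕ}
    (hl : IsLocal c d m) (hl' : IsLocal d c m) (n : ℕ) (hp : p = 2 * m + 1) (hi : i < 2 * p)
    (hs : IsFlipPartition σ (fun x => φ (σ^[n] x))
      (windowSetoid c d i (2 * p : ℕ) p (p + i : ℕ)))
    (ht : IsFlipPartition σ (fun x => φ (σ^[n + 1] x))
      (windowSetoid c d (i + 1 : ℕ) (2 * p : ℕ) p (p + (i + 1) : ℕ))) :
    FlipGraph.Step (partitionGraph hs) (partitionGraph ht) := by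
  refine partitionGraph_step hs ht (fun _ => rfl) ?_ ?_ ?_ ?_ <;>
    simp only [windowSetoid_shift hc hd, windowSetoid_apply] <;> push_cast
  · grind
  · grind
  · intro x y h
    by_cases him : i + 1 + 2 * m ≤ 2 * p
    · obtain ⟨z, h1, h2, h3, h4⟩ :=
        hc.exists_glue_of_isLocal hl x y (i + 1) (2 * p) (by lia) h.1
      exact ⟨z, by grind⟩
    · obtain ⟨z, h1, h2, h3, h4⟩ :=
        hd.exists_glue_of_isLocal hl' x y p (p + (i + 1)) (by lia) h.2
      exact ⟨z, by grind⟩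
  · intro x y h
    by_cases him : i + 1 + 2 * m ≤ 2 * p
    · obtain ⟨z, h1, h2, h3, h4⟩ :=
        hc.exists_glue_of_isLocal hl x y (i + 1) (2 * p + 1) (by lia) h.1
      exact ⟨z, by grind⟩
    · obtain ⟨z, h1, h2, h3, h4⟩ :=
        hd.exists_glue_of_isLocal hl' x y (p + 1) (p + i + 1) (by lia) h.2
      exact ⟨z, by grind⟩

end Steps

/-- Two flip graphs coded by the same system, each code being local in the other, are joined by
a chain of even positive length. -/
theorem exists_even_chain_of_isCoding (hc : IsCoding G σ φ c) (hd : IsCoding H σ φ d) {m : ℕ}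
    (hl : IsLocal c d m) (hl' : IsLocal d c m) :
    ∃ n, 0 < n ∧ Even n ∧ FlipGraph.Chain n G H := by
  obtain ⟨p, hp⟩ : ∃ p, p = 2 * m + 1 := ⟨_, rfl⟩
  have h1 (n : ℕ) := windowSetoid_isFlipPartition hc hd n (a := 0) (b := n) (e := 1) (f := 0)
    (by lia) (by lia)
  have h2 (n : ℕ) := windowSetoid_isFlipPartition hc hd (2 * p + n) (a := n) (b := (2 * p : ℕ))
    (e := p) (f := (p + n : ℕ)) (by lia) (by lia)
  have h3 (n : ℕ) := windowSetoid_isFlipPartition hc hd (4 * p + n) (a := 1) (b := 0)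
    (e := p + n) (f := 3 * p) (by lia) (by lia)
  have c1 := FlipGraph.Chain.of_forall_lt (fun n => partitionGraph (h1 n)) (2 * p)
    fun n _ => windowGraph_step_extend hc hd hl n _ _
  have c2 := FlipGraph.Chain.of_forall_lt (fun n => partitionGraph (h2 n)) (2 * p)
    fun n hn => windowGraph_step_exchange hc hd hl hl' (2 * p + n) hp hn _ _
  have c3 := FlipGraph.Chain.of_forall_lt (fun n => partitionGraph (h3 n)) (2 * p)
    fun n hn => by
      have key : ∀ {a : ℤ} (ht : IsFlipPartition σ (fun x => φ (σ^[4 * p + n + 1] x))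
          (windowSetoid c d 1 0 a (3 * p))), a = p + n + 1 →
          FlipGraph.Step (partitionGraph (h3 n)) (partitionGraph ht) := by
        rintro _ ht rfl
        exact windowGraph_step_shrink hc hd hl' _ (by lia) _ _
      exact key (h3 (n + 1)) (by push_cast; ring)
  have e12 : partitionGraph (h1 (2 * p)) = partitionGraph (h2 0) := by
    refine partitionGraph_congr _ _ ?_ rfl
    ext x y
    simp only [windowSetoid_apply]
    refine ⟨fun h => ⟨by grind, fun i _ _ => hl x y i fun k _ _ => h.1 k (by lia) (by lia)⟩,
      by grind⟩
  have e23 : partitionGraph (h2 (2 * p)) = partitionGraph (h3 0) := by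
    refine partitionGraph_congr _ _ ?_ (by ring_nf)
    ext x y
    simp only [windowSetoid_apply]
    refine ⟨by grind,
      fun h => ⟨fun i _ _ => hl' x y i fun k _ _ => h.2 k (by lia) (by lia), by grind⟩⟩
  obtain ⟨k, hk, c0⟩ := hc.exists_even_chain 0 0 (by simp) (h1 0) fun x y => by
    simp only [windowSetoid_apply]
    grind
  obtain ⟨l, hl, c4⟩ := hd.exists_even_chain (3 * p) (4 * p + 2 * p) (by push_cast; ring)
    (h3 (2 * p)) fun x y => by
      simp only [windowSetoid_apply]
      grind
  rw [e12] at c1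
  rw [e23] at c2
  have := c0.trans (c1.trans (c2.trans (c3.trans c4.symm)))
  refine ⟨_, by lia, ?_, this⟩
  exact hk.add ((even_two_mul p).add ((even_two_mul p).add ((even_two_mul p).add hl)))

end Partition

section Conjugacy

variable {α β : Type} {A J : Matrix α α ℤ} {B : Matrix β β ℤ}

theorem IsFlipPair.eq_involutionMatrix [Fintype α] [DecidableEq α] (h : IsFlipPair A J) {τ : α → α}
    (hτ : ∀ a b, J a b = 1 ↔ τ a = b) : J = involutionMatrix τ := by
  ext a b
  by_cases hab : τ a = b
  · simp [involutionMatrix_apply, hab, (hτ a b).2 hab]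
  · simpa [involutionMatrix_apply, hab] using (h.2.1 a b).resolve_right (mt (hτ a b).1 hab)

theorem IsFlipPair.involutive [Fintype α] [DecidableEq α] (h : IsFlipPair A J) {τ : α → α}
    (hτ : ∀ a b, J a b = 1 ↔ τ a = b) (v : α) : τ (τ v) = v := by
  rw [← hτ, ← involutionMatrix_mul_apply (τ := τ) J, ← h.eq_involutionMatrix hτ, h.2.2.2,
    Matrix.one_apply_eq]

/-- The flip graph of a flip pair. -/
def IsFlipPair.flipGraph [Fintype α] [DecidableEq α] (h : IsFlipPair A J) {τ : α → α}
    (hτ : ∀ a b, J a b = 1 ↔ τ a = b) : FlipGraph where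
  V := α
  Adj a b := A a b = 1
  τ := τ
  τ_τ := h.involutive hτ
  adj_τ {u v} huv := by
    have h1 := congrFun (congrFun h.2.2.1 u) (τ v)
    rw [h.eq_involutionMatrix hτ, mul_involutionMatrix_apply (h.involutive hτ),
      involutionMatrix_mul_apply, Matrix.transpose_apply, h.involutive hτ, huv] at h1
    exact h1.symm

theorem IsFlipPair.toMatPair_flipGraph [Fintype α] [DecidableEq α] (h : IsFlipPair A J) {τ : α → α}
    (hτ : ∀ a b, J a b = 1 ↔ τ a = b) : (h.flipGraph hτ).toMatPair = MatPair.mk α A J := by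
  change MatPair.mk α (Matrix.of fun a b => @ite _ (A a b = 1) (Classical.propDecidable _) 1 0)
    (involutionMatrix τ) = _
  congr 1
  · ext a b
    rcases h.1 a b with hab | hab <;> simp [hab]
  · exact (h.eq_involutionMatrix hτ).symm

theorem shiftEquiv_pow_apply (A : Matrix α α ℤ) (k : ℤ) (x : SFT A) (i : ℤ) :
    ((shiftEquiv A ^ k) x).1 i = x.1 (i + k) := by
  induction k generalizing x with
  | zero => simp
  | succ k ih =>
    rw [_root_.zpow_add_one, Equiv.Perm.mul_apply, ih]
    change x.1 (i + k + 1) = _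
    rw [add_assoc]
  | pred k ih =>
    rw [_root_.zpow_sub_one, Equiv.Perm.mul_apply, ih]
    change x.1 (i + -k - 1) = _
    rw [add_sub_assoc]

variable [Finite α] [TopologicalSpace α] [DiscreteTopology α] [TopologicalSpace β]
  [DiscreteTopology β]

theorem compactSpace_sft (A : Matrix α α ℤ) : CompactSpace (SFT A) := by
  refine isCompact_iff_compactSpace (s := {x : ℤ → α | ∀ i : ℤ, A (x i) (x (i + 1)) = 1}) |>.1 ?_
  refine IsClosed.isCompact ?_
  simp only [Set.ofPred_forall]
  refine isClosed_iInter fun i => ?_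
  have : Continuous fun x : ℤ → α => A (x i) (x (i + 1)) :=
    continuous_of_discreteTopology (f := fun p : α × α => A p.1 p.2) |>.comp <|
      (continuous_apply (A := fun _ : ℤ => α) i).prodMk (continuous_apply (i + 1))
  exact isClosed_eq this continuous_const

/-- A continuous shift-commuting map is a sliding block code. -/
theorem exists_block_radius {θ : SFT A → SFT B} (hθ : Continuous θ)
    (hσ : ∀ x, θ (shiftEquiv A x) = shiftEquiv B (θ x)) :
    ∃ m : ℕ, ∀ (x y : SFT A) (i : ℤ), (∀ k : ℤ, i - m ≤ k → k ≤ i + m → x.1 k = y.1 k) →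
      (θ x).1 i = (θ y).1 i := by
  have := compactSpace_sft A
  have hpow : ∀ (k : ℤ) x, θ ((shiftEquiv A ^ k) x) = (shiftEquiv B ^ k) (θ x) := by
    intro k
    induction k with
    | zero => simp
    | succ k ih =>
      intro x
      rw [_root_.zpow_add_one, _root_.zpow_add_one, Equiv.Perm.mul_apply, Equiv.Perm.mul_apply,
        ih, hσ]
    | pred k ih =>
      intro x
      rw [_root_.zpow_sub_one, _root_.zpow_sub_one, Equiv.Perm.mul_apply, Equiv.Perm.mul_apply, ih]
      congr 1
      rw [Equiv.Perm.eq_inv_iff_eq, ← hσ, ← Equiv.Perm.mul_apply, mul_inv_cancel,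
        Equiv.Perm.one_apply]
  suffices h : ∃ m : ℕ, ∀ x y : SFT A, (∀ k : ℤ, -m ≤ k → k ≤ m → x.1 k = y.1 k) →
      (θ x).1 0 = (θ y).1 0 by
    obtain ⟨m, hm⟩ := h
    refine ⟨m, fun x y i hxy => ?_⟩
    have := hm ((shiftEquiv A ^ i) x) ((shiftEquiv A ^ i) y) fun k _ _ => by
      rw [shiftEquiv_pow_apply, shiftEquiv_pow_apply]
      exact hxy _ (by lia) (by lia)
    simpa [hpow, shiftEquiv_pow_apply] using this
  have hev (i : ℤ) : Continuous fun x : SFT A => x.1 i :=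
    (continuous_apply i).comp continuous_subtype_val
  have hf : Continuous fun x : SFT A => (θ x).1 0 :=
    (continuous_apply 0).comp (continuous_subtype_val.comp hθ)
  have hD : IsCompact {q : SFT A × SFT A | (θ q.1).1 0 ≠ (θ q.2).1 0} := by
    refine IsClosed.isCompact (IsOpen.isClosed_compl
      (s := {q : SFT A × SFT A | (θ q.1).1 0 = (θ q.2).1 0}) ?_)
    exact (isOpen_discrete {q : β × β | q.1 = q.2}).preimage
      ((hf.comp continuous_fst).prodMk (hf.comp continuous_snd))
  obtain ⟨m, hm⟩ := hD.elim_directed_family_closed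
    (fun m : ℕ => {q : SFT A × SFT A | ∀ k : ℤ, -m ≤ k → k ≤ m → q.1.1 k = q.2.1 k})
    (fun m => by
      simp only [Set.ofPred_forall]
      exact isClosed_iInter fun k => isClosed_iInter fun _ => isClosed_iInter fun _ =>
        isClosed_eq ((hev k).comp continuous_fst) ((hev k).comp continuous_snd))
    (by
      ext ⟨x, y⟩
      simp only [Set.mem_inter_iff, Set.mem_iInter, Set.mem_ofPred_eq, Set.mem_empty_iff_false,
        iff_false, not_and]
      intro hxy h
      refine hxy ?_
      rw [show x = y from Subtype.ext (funext fun k => h k.natAbs k (by lia) (by lia))])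
    (directed_of_isDirected_le fun a b hab q hq k _ _ => hq k (by lia) (by lia))
  refine ⟨m, fun x y h => ?_⟩
  by_contra hne
  exact (Set.eq_empty_iff_forall_notMem.1 hm (x, y)) ⟨hne, h⟩

end Conjugacy

/-- **Theorem 2.4.** If the shift-flip systems `(X_A, σ_A, φ_{J,A})` and
`(X_B, σ_B, φ_{K,B})` determined by flip pairs `(A, J)` and `(B, K)` are conjugate, then
there is a strong shift-flip equivalence of some even positive lag `n` from `(A, J)` to
`(B, K)`. -/
theorem stmt4 {𝒜 𝒜' : Type} [Fintype 𝒜] [DecidableEq 𝒜] [Fintype 𝒜'] [DecidableEq 𝒜']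
    [TopologicalSpace 𝒜] [DiscreteTopology 𝒜] [TopologicalSpace 𝒜'] [DiscreteTopology 𝒜']
    (A J : Matrix 𝒜 𝒜 ℤ) (B K : Matrix 𝒜' 𝒜' ℤ)
    (hAJ : IsFlipPair A J) (hBK : IsFlipPair B K)
    (τJ : 𝒜 → 𝒜) (hτJ : ∀ a b, J a b = 1 ↔ τJ a = b)
    (τK : 𝒜' → 𝒜') (hτK : ∀ a b, K a b = 1 ↔ τK a = b)
    (φJ : SFT A → SFT A) (hφJ : ∀ x i, (φJ x).1 i = τJ (x.1 (-i)))
    (φK : SFT B → SFT B) (hφK : ∀ x i, (φK x).1 i = τK (x.1 (-i)))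
    (θ : SFT A ≃ₜ SFT B)
    (hθσ : ∀ x, θ (shiftEquiv A x) = shiftEquiv B (θ x))
    (hθφ : ∀ x, θ (φJ x) = φK (θ x)) :
    ∃ n : ℕ, 0 < n ∧ Even n ∧
      SSFE (MatPair.mk 𝒜 A J) (MatPair.mk 𝒜' B K) n := by
  have hc : IsCoding (hAJ.flipGraph hτJ) (shiftEquiv A) φJ (fun x => x.1) :=
    ⟨fun x => x.2, fun w hw => ⟨⟨w, hw⟩, rfl⟩, fun _ _ => rfl, hφJ⟩
  have hd : IsCoding (hBK.flipGraph hτK) (shiftEquiv A) φJ (fun x => (θ x).1) :=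
    ⟨fun x => (θ x).2, fun w hw => ⟨θ.symm ⟨w, hw⟩, by simp⟩,
      fun x i => by rw [hθσ]; rfl, fun x i => by rw [hθφ, hφK]; rfl⟩
  obtain ⟨m, hm⟩ := exists_block_radius θ.continuous hθσ
  obtain ⟨m', hm'⟩ := exists_block_radius θ.symm.continuous fun y => by
    rw [θ.symm_apply_eq, hθσ, θ.apply_symm_apply]
  have hl : IsLocal (G := hAJ.flipGraph hτJ) (H := hBK.flipGraph hτK)
      (fun x : SFT A => x.1) (fun x => (θ x).1) m := hm
  have hl' : IsLocal (G := hBK.flipGraph hτK) (H := hAJ.flipGraph hτJ)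
      (fun x : SFT A => (θ x).1) (fun x => x.1) m' :=
    fun x y i h => by
      have := hm' (θ x) (θ y) i h
      rwa [θ.symm_apply_apply, θ.symm_apply_apply] at this
  obtain ⟨n, hn, he, h⟩ := exists_even_chain_of_isCoding hc hd
    (hl.mono (le_max_left m m')) (hl'.mono (le_max_right m m'))
  refine ⟨n, hn, he, ?_⟩
  rw [← hAJ.toMatPair_flipGraph hτJ, ← hBK.toMatPair_flipGraph hτK]
  exact h.ssfe
end

section
/- Let (A, J) and (B, K) be flip pairs over finite sets and suppose there is a strong shift-flip equivalence of lag k from (A, J) to (B, K) for some positive integer k. Then the Lind zeta functions of (X_A, σ_A, φ_{J,A}) and (X_B, σ_B, φ_{K,B}) coincide; concretely, for every positive integer m: p_m(σ_A) = p_m(σ_B), p_{2m-1,0}(σ_A, φ_{J,A}) = p_{2m-1,0}(σ_B, φ_{K,B}), and p_{2m,0}(σ_A, φ_{J,A}) + p_{2m,1}(σ_A, φ_{J,A}) = p_{2m,0}(σ_B, φ_{K,B}) + p_{2m,1}(σ_B, φ_{K,B}). (Proposition 3.2.) -/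
open Matrix

/-- `pFix T m = p_m(T)`: the number of points fixed by `T^m`. -/
noncomputable def pFix {X : Type*} (T : Equiv.Perm X) (m : ℕ) : ℕ :=
  Nat.card {x : X // (T ^ m) x = x}

/-- `pFlip T φ m n = p_{m,n}(T, φ)`: the number of points fixed by both `T^m` and `T^n ∘ φ`. -/
noncomputable def pFlip {X : Type*} (T : Equiv.Perm X) (φ : X → X) (m : ℕ) (n : ℤ) : ℕ :=
  Nat.card {x : X // (T ^ m) x = x ∧ (T ^ n) (φ x) = x}

section Dynamics

variable {X Y : Type*} {T : Equiv.Perm X} {U : Equiv.Perm Y} {φ : X → X} {ψ : Y → Y}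

theorem Equiv.Perm.zpow_semiconj (e : X ≃ Y) (he : ∀ x, e (T x) = U (e x)) (n : ℤ) (x : X) :
    e ((T ^ n) x) = (U ^ n) (e x) := by
  have hU : U = e.permCongr T := by
    ext y
    simp [Equiv.permCongr_apply, he]
  have h : ∀ y, (e.permCongr T ^ n) y = e ((T ^ n) (e.symm y)) := by
    intro y
    have := map_zpow e.permCongrHom T n
    have h2 := congrArg (fun V : Equiv.Perm Y => V y) this
    simpa [Equiv.permCongr_apply] using h2.symm
  rw [hU, h, Equiv.symm_apply_apply]

theorem pFix_eq_of_semiconj (e : X ≃ Y) (he : ∀ x, e (T x) = U (e x)) (m : ℕ) :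
    pFix T m = pFix U m := by
  refine Nat.card_congr (e.subtypeEquiv fun x => ?_)
  have h := Equiv.Perm.zpow_semiconj e he m x
  simp only [zpow_natCast] at h
  rw [← h, e.apply_eq_iff_eq]

theorem pFlip_eq_of_semiconj (e : X ≃ Y) (he : ∀ x, e (T x) = U (e x)) (n : ℤ)
    (hφ : ∀ x, (U ^ n) (e (φ x)) = ψ (e x)) (m : ℕ) (k : ℤ) :
    pFlip T φ m (k + n) = pFlip U ψ m k := by
  refine Nat.card_congr (e.subtypeEquiv fun x => ?_)
  have h := Equiv.Perm.zpow_semiconj e he m x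
  simp only [zpow_natCast] at h
  rw [← h, e.apply_eq_iff_eq, ← hφ, ← Equiv.Perm.mul_apply, ← _root_.zpow_add,
    ← Equiv.Perm.zpow_semiconj e he, e.apply_eq_iff_eq]

theorem pFlip_add_period (m : ℕ) (k : ℤ) : pFlip T φ m (k + m) = pFlip T φ m k := by
  refine Nat.card_congr (Equiv.subtypeEquivRight fun x => and_congr_right fun hx => ?_)
  rw [add_comm, _root_.zpow_add, Equiv.Perm.mul_apply, zpow_natCast]
  nth_rewrite 2 [← hx]
  exact (T ^ m).apply_eq_iff_eq

theorem pFlip_add_two (hφ : ∀ x, T (φ (T x)) = φ x) (m : ℕ) (k : ℤ) :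
    pFlip T φ m (k + 2) = pFlip T φ m k := by
  refine (pFlip_eq_of_semiconj (U := T) (ψ := fun x => (T ^ (2 : ℤ)) (φ x)) (Equiv.refl X)
    (fun _ => rfl) 2 (fun _ => rfl) m k).trans ?_
  refine (Nat.card_congr (T.subtypeEquiv fun x => ?_)).symm
  rw [← Equiv.Perm.mul_apply (T ^ m), ← pow_succ, pow_succ', Equiv.Perm.mul_apply,
    T.apply_eq_iff_eq, zpow_two]
  dsimp only
  rw [Equiv.Perm.mul_apply, hφ, ← Equiv.Perm.mul_apply (T ^ k),
    ← _root_.zpow_add_one, add_comm k 1, _root_.zpow_one_add, Equiv.Perm.mul_apply,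
    T.apply_eq_iff_eq]

theorem pFlip_add_two_mul (hφ : ∀ x, T (φ (T x)) = φ x) (m : ℕ) (k j : ℤ) :
    pFlip T φ m (k + 2 * j) = pFlip T φ m k := by
  induction j with
  | zero => simp
  | succ j ih => rw [← ih, ← pFlip_add_two hφ m (k + 2 * j)]; congr 1; omega
  | pred j ih => rw [← ih, ← pFlip_add_two hφ m (k + 2 * (-j - 1))]; congr 1; omega

theorem pFlip_of_odd (hφ : ∀ x, T (φ (T x)) = φ x) {m : ℕ} (hm : Odd m) (k : ℤ) :
    pFlip T φ m k = pFlip T φ m 0 := by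
  obtain ⟨j, hj⟩ | ⟨j, hj⟩ := Int.even_or_odd k
  · rw [show k = 0 + 2 * j by omega, pFlip_add_two_mul hφ]
  · obtain ⟨l, rfl⟩ := hm
    rw [← pFlip_add_period, show k + (2 * l + 1 : ℕ) = 0 + 2 * (j + l + 1) by push_cast; omega,
      pFlip_add_two_mul hφ]

theorem pFlip_add_pFlip_succ (hφ : ∀ x, T (φ (T x)) = φ x) (m : ℕ) (k : ℤ) :
    pFlip T φ m k + pFlip T φ m (k + 1) = pFlip T φ m 0 + pFlip T φ m 1 := by
  obtain ⟨j, hj⟩ | ⟨j, hj⟩ := Int.even_or_odd k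
  · rw [show k = 0 + 2 * j by omega, pFlip_add_two_mul hφ,
      show (0 + 2 * j + 1 : ℤ) = 1 + 2 * j by ring, pFlip_add_two_mul hφ]
  · rw [show k = 1 + 2 * j by omega, pFlip_add_two_mul hφ,
      show (1 + 2 * j + 1 : ℤ) = 0 + 2 * (j + 1) by ring, pFlip_add_two_mul hφ, add_comm]

end Dynamics

theorem shiftEquiv_zpow_apply {α : Type*} (A : Matrix α α ℤ) (n : ℤ) (x : SFT A) (i : ℤ) :
    ((shiftEquiv A ^ n) x).1 i = x.1 (i + n) := by
  induction n generalizing i with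
  | zero => simp
  | succ n ih =>
    rw [add_comm, _root_.zpow_one_add, Equiv.Perm.mul_apply]
    exact (ih (i + 1)).trans (congrArg x.1 (by omega))
  | pred n ih =>
    rw [sub_eq_neg_add, _root_.zpow_add, Equiv.Perm.mul_apply, _root_.zpow_neg_one]
    exact (ih (i - 1)).trans (congrArg x.1 (by omega))

theorem shiftEquiv_flip_shiftEquiv {α : Type*} {A : Matrix α α ℤ} {τ : α → α} {φ : SFT A → SFT A}
    (hφ : ∀ x i, (φ x).1 i = τ (x.1 (-i))) (x : SFT A) :
    shiftEquiv A (φ (shiftEquiv A x)) = φ x := by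
  refine Subtype.ext (funext fun i => ?_)
  show (φ (shiftEquiv A x)).1 (i + 1) = _
  rw [hφ, hφ]
  show τ (x.1 (-(i + 1) + 1)) = _
  rw [show -(i + 1) + 1 = -i by ring]

section ZeroOne

variable {α β : Type*}

theorem IsZeroOne.nonneg {M : Matrix α β ℤ} (h : IsZeroOne M) (a : α) (b : β) : 0 ≤ M a b := by
  rcases h a b with h | h <;> simp [h]

theorem exists_of_mul_apply_eq_one [Fintype β] {R : Matrix α β ℤ} {S : Matrix β α ℤ}
    (hR : IsZeroOne R) (hS : IsZeroOne S) {a b : α} (h : (R * S) a b = 1) :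
    ∃ c, R a c = 1 ∧ S c b = 1 := by
  rw [Matrix.mul_apply] at h
  obtain ⟨c, -, hc⟩ := Finset.exists_ne_zero_of_sum_ne_zero (h.symm ▸ one_ne_zero)
  exact ⟨c, (hR a c).resolve_left (left_ne_zero_of_mul hc),
    (hS c b).resolve_left (right_ne_zero_of_mul hc)⟩

theorem mul_apply_eq_one [Fintype β] {R : Matrix α β ℤ} {S : Matrix β α ℤ}
    (hR : IsZeroOne R) (hS : IsZeroOne S) (hRS : IsZeroOne (R * S)) {a b : α} {c : β}
    (h₁ : R a c = 1) (h₂ : S c b = 1) : (R * S) a b = 1 := by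
  refine (hRS a b).resolve_left fun h => ?_
  rw [Matrix.mul_apply,
    Finset.sum_eq_zero_iff_of_nonneg fun d _ => mul_nonneg (hR.nonneg a d) (hS.nonneg d b)] at h
  simpa [h₁, h₂] using h c (Finset.mem_univ c)

theorem eq_of_mul_isZeroOne [Fintype β] {R : Matrix α β ℤ} {S : Matrix β α ℤ}
    (hR : IsZeroOne R) (hS : IsZeroOne S) (hRS : IsZeroOne (R * S)) {a b : α} {c d : β}
    (hc₁ : R a c = 1) (hc₂ : S c b = 1) (hd₁ : R a d = 1) (hd₂ : S d b = 1) : c = d := by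
  classical
  by_contra hcd
  have h : ∑ k ∈ {c, d}, R a k * S k b ≤ (R * S) a b :=
    Finset.sum_le_sum_of_subset_of_nonneg (Finset.subset_univ _)
      fun k _ _ => mul_nonneg (hR.nonneg a k) (hS.nonneg k b)
  rw [Finset.sum_pair hcd, hc₁, hc₂, hd₁, hd₂, mul_apply_eq_one hR hS hRS hc₁ hc₂] at h
  norm_num at h

theorem IsFlipPair.exists_involutive [Fintype α] [DecidableEq α] {A J : Matrix α α ℤ}
    (h : IsFlipPair A J) :
    ∃ τ : α → α, Function.Involutive τ ∧ ∀ a b, J a b = if τ a = b then 1 else 0 := by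
  obtain ⟨-, hJ, -, hJJ⟩ := h
  have hone : IsZeroOne (J * J) := by
    intro a b
    rw [hJJ, Matrix.one_apply]
    split <;> simp
  have hex : ∀ a, ∃ b, J a b = 1 ∧ J b a = 1 := fun a =>
    exists_of_mul_apply_eq_one hJ hJ (by rw [hJJ, Matrix.one_apply_eq])
  choose τ hτ₁ hτ₂ using hex
  have huniq : ∀ {a b}, J a b = 1 → τ a = b := by
    intro a b hab
    by_contra hne
    have := mul_apply_eq_one hJ hJ hone (hτ₂ a) hab
    rw [hJJ, Matrix.one_apply_ne hne] at this
    exact zero_ne_one this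
  refine ⟨τ, fun a => huniq (hτ₂ a), fun a b => ?_⟩
  split_ifs with hab
  · rw [← hab, hτ₁]
  · exact (hJ a b).resolve_right fun h => hab (huniq h)

end ZeroOne

section Conjugacy

variable {α β : Type*} [Fintype α] [Fintype β]

/-- The relation between points of `SFT (R * S)` and of `SFT (S * R)` whose interleaving is a
walk along `R` and `S` alternately. -/
def Interleaved (R : Matrix α β ℤ) (S : Matrix β α ℤ)
    (x : SFT (R * S)) (y : SFT (S * R)) : Prop :=
  ∀ i, R (x.1 i) (y.1 i) = 1 ∧ S (y.1 i) (x.1 (i + 1)) = 1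

variable {R : Matrix α β ℤ} {S : Matrix β α ℤ}

theorem Interleaved.exists_right (hR : IsZeroOne R) (hS : IsZeroOne S)
    (hSR : IsZeroOne (S * R)) (x : SFT (R * S)) : ∃ y, Interleaved R S x y := by
  choose y hy using fun i => exists_of_mul_apply_eq_one hR hS (x.2 i)
  exact ⟨⟨y, fun i => mul_apply_eq_one hS hR hSR (hy i).2 (hy (i + 1)).1⟩, hy⟩

theorem Interleaved.right_unique (hR : IsZeroOne R) (hS : IsZeroOne S)
    (hRS : IsZeroOne (R * S)) {x : SFT (R * S)} {y y' : SFT (S * R)}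
    (h : Interleaved R S x y) (h' : Interleaved R S x y') : y = y' :=
  Subtype.ext <| funext fun i =>
    eq_of_mul_isZeroOne hR hS hRS (h i).1 (h i).2 (h' i).1 (h' i).2

theorem Interleaved.swap {x : SFT (R * S)} {y : SFT (S * R)} (h : Interleaved R S x y) :
    Interleaved S R y (shiftEquiv _ x) :=
  fun i => ⟨(h i).2, (h (i + 1)).1⟩

theorem Interleaved.shift {x : SFT (R * S)} {y : SFT (S * R)} (h : Interleaved R S x y) :
    Interleaved R S (shiftEquiv _ x) (shiftEquiv _ y) :=
  fun i => h (i + 1)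

theorem Interleaved.exists_equiv (hR : IsZeroOne R) (hS : IsZeroOne S)
    (hRS : IsZeroOne (R * S)) (hSR : IsZeroOne (S * R)) :
    ∃ e : SFT (R * S) ≃ SFT (S * R), ∀ x, Interleaved R S x (e x) := by
  choose f hf using Interleaved.exists_right hR hS hSR
  refine ⟨Equiv.ofBijective f ⟨fun x x' hxx' => ?_, fun y => ?_⟩, hf⟩
  · have h' := (hf x').swap
    rw [← hxx'] at h'
    exact (shiftEquiv _).injective (Interleaved.right_unique hS hR hSR (hf x).swap h')
  · obtain ⟨x, hx⟩ := Interleaved.exists_right hS hR hRS y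
    refine ⟨(shiftEquiv _).symm x, (shiftEquiv _).injective ?_⟩
    refine Interleaved.right_unique hR hS hRS (x := x) ?_ hx.swap
    simpa using (hf ((shiftEquiv _).symm x)).shift

/-- `y` is the image of `x` under the flip determined by `J`. -/
def IsFlipOf {A : Matrix α α ℤ} (J : Matrix α α ℤ) (x y : SFT A) : Prop :=
  ∀ i, J (x.1 (-i)) (y.1 i) = 1

/-- A shift-commuting bijection that carries the flip of `P` to the flip of `Q` up to a power
of the shift. -/
def FlipConj (P Q : MatPair) : Prop :=
  ∃ (e : SFT P.A ≃ SFT Q.A) (n : ℤ), (∀ x, e (shiftEquiv P.A x) = shiftEquiv Q.A (e x)) ∧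
    ∀ x y, IsFlipOf P.J x y → IsFlipOf Q.J (e x) ((shiftEquiv Q.A ^ n) (e y))

theorem FlipConj.refl (P : MatPair) : FlipConj P P :=
  ⟨Equiv.refl _, 0, fun _ => rfl, fun _ _ h => h⟩

theorem FlipConj.trans {P Q V : MatPair} (h : FlipConj P Q) (h' : FlipConj Q V) :
    FlipConj P V := by
  obtain ⟨e, n, he, hn⟩ := h
  obtain ⟨e', n', he', hn'⟩ := h'
  refine ⟨e.trans e', n' + n, fun x => by simp [he, he'], fun x y hxy => ?_⟩
  have := hn' _ _ (hn x y hxy)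
  rwa [Equiv.Perm.zpow_semiconj e' he', ← Equiv.Perm.mul_apply, ← _root_.zpow_add] at this

theorem HalfElemEquiv.flipConj {P Q : MatPair} (hP : P.IsFlip) (hQ : Q.IsFlip)
    (h : HalfElemEquiv P Q) : FlipConj P Q := by
  obtain ⟨ι, A, J⟩ := P
  obtain ⟨κ, B, K⟩ := Q
  obtain ⟨R, S, hR, hS, hA, hB, hSR⟩ := h
  change Matrix ι κ ℤ at R
  change Matrix κ ι ℤ at S
  change A = R * S at hA
  change B = S * R at hB
  change S = K * Rᵀ * J at hSR
  subst hA hB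
  obtain ⟨τ, hτ, hJ⟩ := hP.exists_involutive
  obtain ⟨ρ, hρ, hK⟩ := hQ.exists_involutive
  dsimp only at τ ρ hτ hρ hJ hK
  have hRS₀ : IsZeroOne (R * S) := hP.1
  have hSR₀ : IsZeroOne (S * R) := hQ.1
  have hflip : ∀ c a, S c a = R (τ a) (ρ c) := by
    intro c a
    have hτ' : ∀ b, τ b = a ↔ b = τ a := fun b => hτ.eq_iff
    rw [hSR]
    simp [Matrix.mul_apply, hJ, hK, hτ']
  obtain ⟨e, he⟩ := Interleaved.exists_equiv hR hS hRS₀ hSR₀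
  refine ⟨e, -1, fun x => Interleaved.right_unique hR hS hRS₀ (he _) (he x).shift,
    fun x y hxy i => ?_⟩
  have hy : ∀ i, τ (x.1 (-i)) = y.1 i := by
    intro i
    by_contra hne
    simpa [hJ, hne] using hxy i
  obtain ⟨h₁, h₂⟩ := he y (i - 1)
  rw [sub_add_cancel, hflip, ← hy, hτ] at h₂
  rw [← hy, show -(i - 1) = -i + 1 by ring, ← hρ ((e y).1 (i - 1)), ← hflip] at h₁
  have heq := eq_of_mul_isZeroOne hR hS hRS₀ h₂ h₁ (he x (-i)).1 (he x (-i)).2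
  show K _ _ = 1
  rw [hK, shiftEquiv_zpow_apply, if_pos]
  rw [← heq]
  exact hρ _

theorem SSFE.flipConj {P Q : MatPair} {k : ℕ} (h : SSFE P Q k) : FlipConj P Q := by
  obtain ⟨c, rfl, rfl, hc, hstep⟩ := h
  suffices ∀ i, FlipConj (c 0) (c i) from this _
  intro i
  induction i using Fin.induction with
  | zero => exact FlipConj.refl _
  | succ i ih => exact ih.trans ((hstep i).flipConj (hc _) (hc _))

end Conjugacy

/-- **Proposition 3.2.** If there is a strong shift-flip equivalence of lag `k`
from the flip pair `(A, J)` to the flip pair `(B, K)`, then the Lind zeta functions of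
`(X_A, σ_A, φ_{J,A})` and `(X_B, σ_B, φ_{K,B})` coincide: for every positive integer `m`,
`p_m(σ_A) = p_m(σ_B)`, `p_{2m-1,0}(σ_A, φ_{J,A}) = p_{2m-1,0}(σ_B, φ_{K,B})`, and
`p_{2m,0} + p_{2m,1}` agree for the two systems. -/
theorem stmt8 {𝒜 𝒜' : Type} [Fintype 𝒜] [DecidableEq 𝒜] [Fintype 𝒜'] [DecidableEq 𝒜']
    (A J : Matrix 𝒜 𝒜 ℤ) (B K : Matrix 𝒜' 𝒜' ℤ)
    (hAJ : IsFlipPair A J) (hBK : IsFlipPair B K)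
    (τJ : 𝒜 → 𝒜) (hτJ : ∀ a b, J a b = 1 ↔ τJ a = b)
    (τK : 𝒜' → 𝒜') (hτK : ∀ a b, K a b = 1 ↔ τK a = b)
    (φJ : SFT A → SFT A) (hφJ : ∀ x i, (φJ x).1 i = τJ (x.1 (-i)))
    (φK : SFT B → SFT B) (hφK : ∀ x i, (φK x).1 i = τK (x.1 (-i)))
    (k : ℕ) (hk : 0 < k)
    (h : SSFE (MatPair.mk 𝒜 A J) (MatPair.mk 𝒜' B K) k)
    (m : ℕ) (hm : 1 ≤ m) :
    pFix (shiftEquiv A) m = pFix (shiftEquiv B) m ∧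
    pFlip (shiftEquiv A) φJ (2 * m - 1) 0 = pFlip (shiftEquiv B) φK (2 * m - 1) 0 ∧
    pFlip (shiftEquiv A) φJ (2 * m) 0 + pFlip (shiftEquiv A) φJ (2 * m) 1
      = pFlip (shiftEquiv B) φK (2 * m) 0 + pFlip (shiftEquiv B) φK (2 * m) 1 := by
  obtain ⟨e, n, he, hn⟩ := h.flipConj
  have hconj : ∀ x, (shiftEquiv B ^ n) (e (φJ x)) = φK (e x) := fun x =>
    Subtype.ext <| funext fun i => by
      rw [hφK]
      exact ((hτK _ _).1 (hn x (φJ x) (fun i => (hτJ _ _).2 (hφJ x i).symm) i)).symm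
  have hJ := shiftEquiv_flip_shiftEquiv hφJ
  have hp : ∀ m k, pFlip (shiftEquiv A) φJ m (k + n) = pFlip (shiftEquiv B) φK m k :=
    pFlip_eq_of_semiconj e he n hconj
  refine ⟨pFix_eq_of_semiconj e he m, ?_, ?_⟩
  · rw [← hp, pFlip_of_odd hJ ⟨m - 1, by omega⟩ (0 + n)]
  · rw [← hp, ← hp, zero_add, add_comm 1 n, pFlip_add_pFlip_succ hJ]
end
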